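/- For all n ≥ 1, the number of rooted labeled forests on [n] avoiding all three patterns 321, 2143, and 3142 equals n! + ∑ (n!/2^ℓ)·C(n−k−1,ℓ−1)·C(k,ℓ), where the sum is over all pairs (ℓ,k) with 1 ≤ ℓ ≤ k ≤ n and ℓ+k ≤ n, and C(a,b) denotes the binomial coefficient. -/

import Mathlib

/-- A rooted labeled forest on `[n]`, encoded as a parent function
`p : Fin n → Option (Fin n)` (`p v = none` means `v` is a root).
Acyclicity is expressed by the existence of a depth function strictly
decreasing from each vertex to its parent. -/
def IsForest {n : ℕ} (p : Fin n → Option (Fin n)) : Prop :=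
  ∃ d : Fin n → ℕ, ∀ v w : Fin n, p v = some w → d w < d v

/-- `StrictAnc p a b` means `a` is a strict ancestor of `b` in the forest `p`. -/
def StrictAnc {n : ℕ} (p : Fin n → Option (Fin n)) (a b : Fin n) : Prop :=
  Relation.TransGen (fun x y : Fin n => p y = some x) a b

/-- The forest `p` contains the pattern `σ` (given in one-line notation):
there is a chain of vertices along some root-to-vertex path whose labels
are order-isomorphic to `σ`. -/
def ForestContains {n : ℕ} (p : Fin n → Option (Fin n)) (σ : List ℕ) : Prop :=
  ∃ u : Fin σ.length → Fin n,
    (∀ i j : Fin σ.length, i < j → StrictAnc p (u i) (u j)) ∧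
    (∀ i j : Fin σ.length, σ.get i < σ.get j ↔ u i < u j)

/-- The forest `p` avoids the pattern `σ`. -/
def ForestAvoids {n : ℕ} (p : Fin n → Option (Fin n)) (σ : List ℕ) : Prop :=
  ¬ ForestContains p σ

/-- Number of cycles (including fixed points) in the cycle decomposition of a
permutation. -/
def permNumCycles {n : ℕ} (π : Equiv.Perm (Fin n)) : ℕ :=
  π.cycleType.card + (Finset.univ.filter fun x => π x = x).card

/-- Unsigned Stirling number of the first kind: the number of permutations of
`[n]` with exactly `k` cycles. -/
noncomputable def stirlingFirst (n k : ℕ) : ℕ :=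
  Nat.card {π : Equiv.Perm (Fin n) // permNumCycles π = k}

/-- Stirling number of the second kind: the number of partitions of `[n]`
into `k` nonempty subsets. -/
noncomputable def stirlingSecond (n k : ℕ) : ℕ :=
  Nat.card {P : Finpartition (Finset.univ : Finset (Fin n)) // P.parts.card = k}

/-- The Bell number: the number of set partitions of `[n]`. -/
noncomputable def bellNumber (n : ℕ) : ℕ :=
  Nat.card (Finpartition (Finset.univ : Finset (Fin n)))

/-- A vertex is a top-down maximum if it is larger than all of its ancestors. -/
def IsTopDownMax {n : ℕ} (p : Fin n → Option (Fin n)) (v : Fin n) : Prop :=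
  ∀ u : Fin n, StrictAnc p u v → u < v

open Finset PowerSeries

section Structure

variable {n : ℕ} {p : Fin n → Option (Fin n)}

theorem IsForest.ne_of_strictAnc (hp : IsForest p) {a b : Fin n} (h : StrictAnc p a b) :
    a ≠ b := by
  obtain ⟨d, hd⟩ := hp
  have key : d a < d b := by
    induction h with
    | single h => exact hd _ _ h
    | tail _ h ih => exact ih.trans (hd _ _ h)
  rintro rfl
  exact lt_irrefl _ key

theorem forestContains_321 {a b c : Fin n} (hab : StrictAnc p a b) (hbc : StrictAnc p b c)
    (h₁ : b < a) (h₂ : c < b) : ForestContains p [3, 2, 1] := by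
  refine ⟨![a, b, c], ?_, ?_⟩
  · have := hab.trans hbc
    simpa [Fin.forall_fin_succ, StrictAnc] using ⟨⟨hab, this⟩, hbc⟩
  · simp [Fin.forall_fin_succ]
    grind

theorem forestContains_2143 {a b c d : Fin n} (hab : StrictAnc p a b) (hbc : StrictAnc p b c)
    (hcd : StrictAnc p c d) (h₁ : b < a) (h₂ : a < d) (h₃ : d < c) :
    ForestContains p [2, 1, 4, 3] := by
  refine ⟨![a, b, c, d], ?_, ?_⟩
  · have := hab.trans hbc
    have := hbc.trans hcd
    have := (hab.trans hbc).trans hcd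
    simp_all [Fin.forall_fin_succ, StrictAnc]
  · simp [Fin.forall_fin_succ]
    grind

theorem forestContains_3142 {a b c d : Fin n} (hab : StrictAnc p a b) (hbc : StrictAnc p b c)
    (hcd : StrictAnc p c d) (h₁ : b < d) (h₂ : d < a) (h₃ : a < c) :
    ForestContains p [3, 1, 4, 2] := by
  refine ⟨![a, b, c, d], ?_, ?_⟩
  · have := hab.trans hbc
    have := hbc.trans hcd
    have := (hab.trans hbc).trans hcd
    simp_all [Fin.forall_fin_succ, StrictAnc]
  · simp [Fin.forall_fin_succ]
    grind

/-- In a forest avoiding 321, 2143 and 3142, no root-to-vertex path has two descents. -/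
theorem not_two_descents (hp : IsForest p) (h321 : ForestAvoids p [3, 2, 1])
    (h2143 : ForestAvoids p [2, 1, 4, 3]) (h3142 : ForestAvoids p [3, 1, 4, 2])
    {a b c d : Fin n} (hab : p b = some a) (hba : b < a)
    (hbc : Relation.ReflTransGen (fun x y : Fin n => p y = some x) b c)
    (hcd : p d = some c) (hdc : d < c) : False := by
  have ab : StrictAnc p a b := .single hab
  have cd : StrictAnc p c d := .single hcd
  obtain rfl | bc := Relation.reflTransGen_iff_eq_or_transGen.1 hbc
  · exact h321 (forestContains_321 ab cd hba hdc)
  have bc : StrictAnc p b c := bc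
  have hac := hp.ne_of_strictAnc (ab.trans bc)
  have hbd := hp.ne_of_strictAnc (bc.trans cd)
  have had := hp.ne_of_strictAnc ((ab.trans bc).trans cd)
  have hac' : a < c := hac.lt_of_le (le_of_not_gt fun h =>
    h321 (forestContains_321 (ab.trans bc) cd h hdc))
  have hbd' : b < d := hbd.lt_of_le (le_of_not_gt fun h =>
    h321 (forestContains_321 ab (bc.trans cd) hba h))
  rcases had.lt_or_gt with h | h
  · exact h2143 (forestContains_2143 ab bc cd hba h hdc)
  · exact h3142 (forestContains_3142 ab bc cd hbd' h hac')

/-- The parents that `v` may have in a forest all of whose root-to-vertex paths have at most one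
descent, when `b` marks the vertices whose path has a descent. -/
def allowedParents (b : Fin n → Bool) (v : Fin n) : Finset (Option (Fin n)) :=
  if b v then
    (({w | b w = true ∧ w < v} : Finset (Fin n)) ∪ ({w | b w = false ∧ v < w} : Finset (Fin n))).map .some
  else insertNone {w | b w = false ∧ w < v}

theorem mem_allowedParents {b : Fin n → Bool} {v : Fin n} {o : Option (Fin n)} :
    o ∈ allowedParents b v ↔ (o = none ∧ b v = false) ∨
      ∃ w, o = some w ∧ w ≠ v ∧ (b v = true ↔ b w = true ∨ v < w) ∧
        (b w = true → w < v) := by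
  unfold allowedParents
  cases o <;> cases hb : b v <;> simp
  · rename_i w
    cases hw : b w <;> grind
  · rename_i w
    cases hw : b w <;> grind

theorem StrictAnc.lt_or_of_allowedParents {b : Fin n → Bool} (hb : ∀ v, p v ∈ allowedParents b v)
    {x y : Fin n} (h : StrictAnc p x y) :
    x < y ∧ (b x = true → b y = true) ∨ b x = false ∧ b y = true := by
  have step : ∀ {x y : Fin n}, p y = some x →
      x < y ∧ (b x = true → b y = true) ∨ b x = false ∧ b y = true := by
    intro x y hxy
    have := mem_allowedParents.1 (hb y)
    grind
  induction h with
  | single h => exact step h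
  | tail _ h ih =>
    have := step h
    grind

theorem isForest_of_allowedParents {b : Fin n → Bool} (hb : ∀ v, p v ∈ allowedParents b v) :
    IsForest p := by
  refine ⟨fun v => if b v then n + v else v, fun v w h => ?_⟩
  have := mem_allowedParents.1 (hb v)
  have := w.2
  grind

theorem avoids_of_allowedParents {b : Fin n → Bool} (hb : ∀ v, p v ∈ allowedParents b v) :
    ForestAvoids p [3, 2, 1] ∧ ForestAvoids p [2, 1, 4, 3] ∧ ForestAvoids p [3, 1, 4, 2] := by
  refine ⟨?_, ?_, ?_⟩
  · rintro ⟨u, hu, hs⟩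
    have h₁ := (hu 0 1 (by decide)).lt_or_of_allowedParents hb
    have h₂ := (hu 1 2 (by decide)).lt_or_of_allowedParents hb
    have := (hs 1 0).1 (by decide)
    have := (hs 2 1).1 (by decide)
    grind
  · rintro ⟨u, hu, hs⟩
    have h₁ := (hu 0 1 (by decide)).lt_or_of_allowedParents hb
    have h₂ := (hu 1 2 (by decide)).lt_or_of_allowedParents hb
    have h₃ := (hu 2 3 (by decide)).lt_or_of_allowedParents hb
    have := (hs 1 0).1 (by decide)
    have := (hs 3 2).1 (by decide)
    grind
  · rintro ⟨u, hu, hs⟩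
    have h₁ := (hu 0 1 (by decide)).lt_or_of_allowedParents hb
    have h₂ := (hu 1 2 (by decide)).lt_or_of_allowedParents hb
    have h₃ := (hu 2 3 (by decide)).lt_or_of_allowedParents hb
    have := (hs 1 0).1 (by decide)
    have := (hs 3 2).1 (by decide)
    grind

theorem exists_allowedParents (hp : IsForest p) (h321 : ForestAvoids p [3, 2, 1])
    (h2143 : ForestAvoids p [2, 1, 4, 3]) (h3142 : ForestAvoids p [3, 1, 4, 2]) :
    ∃ b : Fin n → Bool, ∀ v, p v ∈ allowedParents b v := by
  classical
  let B : Fin n → Prop := fun v => ∃ x y, p y = some x ∧ y < x ∧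
    Relation.ReflTransGen (fun x y : Fin n => p y = some x) y v
  have hB : ∀ {v w}, p v = some w → (B v ↔ B w ∨ v < w) := by
    intro v w hvw
    constructor
    · rintro ⟨x, y, hxy, hlt, hyv⟩
      obtain rfl | ⟨u, hyu, huv⟩ := hyv.cases_tail
      · right
        grind
      · obtain rfl : u = w := by grind
        exact .inl ⟨x, y, hxy, hlt, hyu⟩
    · rintro (⟨x, y, hxy, hlt, hyw⟩ | h)
      · exact ⟨x, y, hxy, hlt, hyw.tail hvw⟩
      · exact ⟨w, v, hvw, h, .refl⟩
  refine ⟨fun v => decide (B v), fun v => mem_allowedParents.2 ?_⟩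
  rcases hv : p v with _ | w
  · left
    refine ⟨rfl, decide_eq_false ?_⟩
    rintro ⟨x, y, hxy, hlt, hyv⟩
    obtain rfl | ⟨u, hyu, huv⟩ := hyv.cases_tail <;> simp_all
  · right
    have hne := hp.ne_of_strictAnc (.single hv)
    refine ⟨w, rfl, hne, by simpa using hB hv, fun h => ?_⟩
    obtain ⟨x, y, hxy, hlt, hyw⟩ := of_decide_eq_true h
    exact hne.lt_of_le (le_of_not_gt fun h => not_two_descents hp h321 h2143 h3142 hxy hlt hyw hv h)

theorem allowedParents_unique {b b' : Fin n → Bool} (hb : ∀ v, p v ∈ allowedParents b v)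
    (hb' : ∀ v, p v ∈ allowedParents b' v) : b = b' := by
  obtain ⟨d, hd⟩ := isForest_of_allowedParents hb
  funext v
  induction h : d v using Nat.strong_induction_on generalizing v with
  | _ k ih =>
    have h₁ := mem_allowedParents.1 (hb v)
    have h₂ := mem_allowedParents.1 (hb' v)
    rcases hv : p v with _ | w
    · grind
    · have := ih _ (h ▸ hd v w hv) w rfl
      grind

theorem card_avoiding_eq_sum (n : ℕ) :
    Nat.card {p : Fin n → Option (Fin n) //
        IsForest p ∧ ForestAvoids p [3, 2, 1] ∧ ForestAvoids p [2, 1, 4, 3] ∧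
        ForestAvoids p [3, 1, 4, 2]} =
      ∑ b : Fin n → Bool, ∏ v, #(allowedParents b v) := by
  classical
  rw [Nat.card_eq_fintype_card, Fintype.card_subtype]
  have : ({p | IsForest p ∧ ForestAvoids p [3, 2, 1] ∧ ForestAvoids p [2, 1, 4, 3] ∧
        ForestAvoids p [3, 1, 4, 2]} : Finset (Fin n → Option (Fin n))) =
      univ.biUnion fun b => Fintype.piFinset (allowedParents b) := by
    ext p
    simp only [mem_filter, mem_univ, true_and, mem_biUnion, Fintype.mem_piFinset]
    constructor
    · rintro ⟨h₀, h₁, h₂, h₃⟩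
      exact exists_allowedParents h₀ h₁ h₂ h₃
    · rintro ⟨b, hb⟩
      exact ⟨isForest_of_allowedParents hb, avoids_of_allowedParents hb⟩
  rw [this, card_biUnion]
  · simp
  · intro b _ b' _ hne
    refine disjoint_left.2 fun p hp hp' => hne ?_
    exact allowedParents_unique (Fintype.mem_piFinset.1 hp) (Fintype.mem_piFinset.1 hp')

end Structure

section Counting

/-- The number of allowed parents of `v` when `i` unmarked and `j` marked vertices are added below
all others. -/
def parentWeight {n : ℕ} (i j : ℕ) (b : Fin n → Bool) (v : Fin n) : ℕ :=
  if b v then j + ∑ w, (if b w = true ∧ w < v then 1 else 0) +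
    ∑ w, (if b w = false ∧ v < w then 1 else 0)
  else i + 1 + ∑ w, (if b w = false ∧ w < v then 1 else 0)

theorem card_allowedParents {n : ℕ} (b : Fin n → Bool) (v : Fin n) :
    #(allowedParents b v) = parentWeight 0 0 b v := by
  unfold allowedParents parentWeight
  split_ifs
  · rw [card_map, card_union_of_disjoint, card_filter, card_filter, zero_add]
    rw [disjoint_left]
    grind
  · simp [card_insertNone, add_comm]

/-- The number of vertices not marked by `b`. -/
def numUnmarked {n : ℕ} (b : Fin n → Bool) : ℕ := ∑ w, if b w = false then 1 else 0

/-- The total weight of the markings of `Fin n` with exactly `r` unmarked vertices. -/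
def totalWeight (n i j r : ℕ) : ℕ :=
  ∑ b : Fin n → Bool, if numUnmarked b = r then ∏ v, parentWeight i j b v else 0

theorem totalWeight_zero (i j r : ℕ) : totalWeight 0 i j r = if r = 0 then 1 else 0 := by
  simp [totalWeight, numUnmarked, eq_comm (a := r)]

theorem numUnmarked_cons {n : ℕ} (c : Bool) (b : Fin n → Bool) :
    numUnmarked (Fin.cons c b : Fin (n + 1) → Bool) =
      (if c = false then 1 else 0) + numUnmarked b := by
  simp only [numUnmarked, Fin.sum_univ_succ, Fin.cons_zero, Fin.cons_succ]

theorem parentWeight_cons_succ {n : ℕ} (i j : ℕ) (c : Bool) (b : Fin n → Bool) (v : Fin n) :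
    parentWeight i j (Fin.cons c b : Fin (n + 1) → Bool) v.succ =
      if c then parentWeight i (j + 1) b v else parentWeight (i + 1) j b v := by
  simp only [parentWeight, Fin.sum_univ_succ, Fin.cons_zero, Fin.cons_succ, Fin.succ_lt_succ_iff,
    Fin.succ_pos, Fin.not_lt_zero]
  cases c <;> cases b v <;> simp <;> omega

theorem parentWeight_cons_zero {n : ℕ} (i j : ℕ) (c : Bool) (b : Fin n → Bool) :
    parentWeight i j (Fin.cons c b : Fin (n + 1) → Bool) 0 =
      if c then j + numUnmarked b else i + 1 := by
  simp only [parentWeight, Fin.sum_univ_succ, Fin.cons_zero, Fin.cons_succ, numUnmarked,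
    Fin.succ_pos, Fin.not_lt_zero]
  cases c <;> simp

theorem totalWeight_succ (n i j r : ℕ) :
    totalWeight (n + 1) i j r = (j + r) * totalWeight n i (j + 1) r +
      if r = 0 then 0 else (i + 1) * totalWeight n (i + 1) j (r - 1) := by
  unfold totalWeight
  have hcons : ∀ c (b : Fin n → Bool),
      Fin.consEquiv (fun _ : Fin (n + 1) => Bool) (c, b) = Fin.cons c b := fun _ _ => rfl
  rw [← (Fin.consEquiv fun _ : Fin (n + 1) => Bool).sum_comp, Fintype.sum_prod_type,
    Fintype.sum_bool]
  simp only [hcons, Fin.prod_univ_succ, numUnmarked_cons, parentWeight_cons_succ,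
    parentWeight_cons_zero]
  congr 1
  · rw [mul_sum]
    refine sum_congr rfl fun b _ => ?_
    simp only [mul_ite, mul_zero]
    split_ifs <;> simp_all
  · simp only [Bool.false_eq_true, if_true, if_false]
    split_ifs with h
    · subst h
      exact sum_eq_zero fun b _ => by simp
    · rw [mul_sum]
      refine sum_congr rfl fun b _ => ?_
      have : 1 + numUnmarked b = r ↔ numUnmarked b = r - 1 := by omega
      simp [this]

/-- The power series `(X - X² / 2) / (1 - X)`. -/
noncomputable def stepSeries : ℚ⟦X⟧ := X * (1 + C (1 / 2) * X * PowerSeries.mk 1)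

theorem derivative_mk_one : d⁄dX ℚ (PowerSeries.mk 1 : ℚ⟦X⟧) = PowerSeries.mk 1 ^ 2 := by
  have h : (PowerSeries.mk 1 : ℚ⟦X⟧) * (1 - X) = 1 := mk_one_mul_one_sub_eq_one ℚ
  have h' := congrArg (d⁄dX ℚ) h
  simp only [Derivation.leibniz, smul_eq_mul, map_sub, Derivation.map_one_eq_zero, derivative_X]
    at h'
  linear_combination (PowerSeries.mk 1 : ℚ⟦X⟧) * h' + (-d⁄dX ℚ (PowerSeries.mk 1 : ℚ⟦X⟧)) * h

theorem derivative_stepSeries : d⁄dX ℚ stepSeries = 1 + stepSeries * PowerSeries.mk 1 := by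
  have h : (PowerSeries.mk 1 : ℚ⟦X⟧) * (1 - X) = 1 := mk_one_mul_one_sub_eq_one ℚ
  have h2 : (C (1 / 2) : ℚ⟦X⟧) * 2 = 1 := by
    rw [← map_ofNat C 2, ← map_mul]
    norm_num
  simp only [stepSeries, Derivation.leibniz, smul_eq_mul, map_add, Derivation.map_one_eq_zero,
    derivative_X, derivative_mk_one, derivative_C]
  linear_combination (X * PowerSeries.mk 1 : ℚ⟦X⟧) * h2

theorem derivative_mk_one_pow_mul_stepSeries_pow (j r : ℕ) :
    d⁄dX ℚ ((PowerSeries.mk 1 : ℚ⟦X⟧) ^ j * stepSeries ^ r) =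
      ((j + r : ℕ) : ℚ⟦X⟧) * (PowerSeries.mk 1 ^ (j + 1) * stepSeries ^ r) +
        if r = 0 then 0 else (r : ℚ⟦X⟧) * (PowerSeries.mk 1 ^ j * stepSeries ^ (r - 1)) := by
  rw [Derivation.leibniz, Derivation.leibniz_pow, Derivation.leibniz_pow, derivative_mk_one,
    derivative_stepSeries]
  simp only [smul_eq_mul, nsmul_eq_mul]
  cases j <;> cases r <;> simp [-mul_eq_mul_left_iff, -mul_eq_mul_right_iff] <;> ring

theorem totalWeight_eq (n i j r : ℕ) :
    (totalWeight n i j r : ℚ) =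
      (i + r).choose r * n.factorial * coeff n ((PowerSeries.mk 1 : ℚ⟦X⟧) ^ j * stepSeries ^ r) := by
  induction n generalizing i j r with
  | zero =>
    rcases r with _ | r <;> simp [totalWeight_zero, stepSeries]
  | succ n ih =>
    have h := congrArg (coeff n) (derivative_mk_one_pow_mul_stepSeries_pow j r)
    rw [coeff_derivative] at h
    rw [totalWeight_succ]
    push_cast [ih, Nat.factorial_succ]
    rcases r with _ | r
    · simp only [if_true, add_zero, ← nsmul_eq_mul, map_nsmul] at h
      simp only [nsmul_eq_mul] at h
      simp only [Nat.choose_zero_right, if_true, Nat.cast_zero, Nat.cast_one]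
      linear_combination (-(n.factorial : ℚ)) * h
    · simp only [Nat.succ_ne_zero, if_false, ← nsmul_eq_mul, map_add, map_nsmul,
        Nat.add_sub_cancel] at h ⊢
      simp only [nsmul_eq_mul] at h
      push_cast [ih] at h ⊢
      have hc : ((i + 1 : ℕ) : ℚ) * (i + 1 + r).choose r =
          (i + (r + 1)).choose (r + 1) * (r + 1 : ℕ) := by
        norm_cast
        have := Nat.choose_succ_right_eq (i + 1 + r) r
        rw [Nat.add_sub_cancel] at this
        rw [show i + (r + 1) = i + 1 + r by ring, this, mul_comm]
      push_cast at hc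
      linear_combination (-((i + (r + 1)).choose (r + 1) * n.factorial : ℚ)) * h +
        (n.factorial * coeff n ((PowerSeries.mk 1 : ℚ⟦X⟧) ^ j * stepSeries ^ r)) * hc

theorem two_pow_dvd_factorial {l n : ℕ} (h : 2 * l ≤ n) : 2 ^ l ∣ n.factorial := by
  refine dvd_trans ?_ (Nat.factorial_dvd_factorial h)
  clear h
  induction l with
  | zero => simp
  | succ l ih =>
    rw [show 2 * (l + 1) = 2 * l + 1 + 1 by ring, Nat.factorial_succ, Nat.factorial_succ, pow_succ,
      mul_comm]
    exact mul_dvd_mul (by omega) (ih.mul_left _)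

theorem coeff_stepSeries_pow (n r : ℕ) :
    coeff n (stepSeries ^ r) = (if r = n then 1 else 0) +
      ∑ l ∈ Icc 1 n, if l ≤ r ∧ l + r ≤ n then
        (1 / 2 ^ l : ℚ) * (n - r - 1).choose (l - 1) * r.choose l else 0 := by
  have hterm : ∀ l, coeff n (X ^ r * ((C (1 / 2) * X * PowerSeries.mk 1 : ℚ⟦X⟧) ^ l *
      1 ^ (r - l) * (r.choose l : ℚ⟦X⟧))) = if l + r ≤ n then
        (1 / 2 ^ l : ℚ) * r.choose l * coeff (n - (l + r)) ((PowerSeries.mk 1 : ℚ⟦X⟧) ^ l)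
        else 0 := by
    intro l
    have : X ^ r * ((C (1 / 2) * X * PowerSeries.mk 1 : ℚ⟦X⟧) ^ l *
        1 ^ (r - l) * (r.choose l : ℚ⟦X⟧)) =
        X ^ (l + r) * (C (1 / 2 ^ l * r.choose l : ℚ) * PowerSeries.mk 1 ^ l) := by
      rw [map_mul, map_natCast, ← one_div_pow, map_pow]
      ring
    rw [this, coeff_X_pow_mul', coeff_C_mul]
  rw [stepSeries, mul_pow, add_comm, add_pow, mul_sum, map_sum]
  simp only [hterm]
  rw [range_eq_Ico, sum_eq_sum_Ico_succ_bot (by omega)]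
  congr 1
  · simp only [zero_add, pow_zero, coeff_one, Nat.choose_zero_right]
    split_ifs <;> first | omega | simp
  · rw [← sum_filter, ← sum_filter]
    refine sum_congr (by ext l; simp; omega) fun l hl => ?_
    simp only [mem_filter, mem_Icc] at hl
    obtain ⟨m, rfl⟩ : ∃ m, l = m + 1 := ⟨l - 1, by omega⟩
    rw [mk_one_pow_eq_mk_choose_add, coeff_mk, Nat.add_sub_cancel,
      show m + (n - (m + 1 + r)) = n - r - 1 by omega]
    ring

theorem numUnmarked_le {n : ℕ} (b : Fin n → Bool) : numUnmarked b ≤ n := by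
  simpa [numUnmarked] using card_filter_le (univ : Finset (Fin n)) fun w => b w = false

theorem sum_parentWeight_eq (n i j : ℕ) :
    ∑ b : Fin n → Bool, ∏ v, parentWeight i j b v = ∑ r ∈ range (n + 1), totalWeight n i j r := by
  unfold totalWeight
  rw [sum_comm]
  refine sum_congr rfl fun b _ => ?_
  rw [sum_ite_eq, if_pos (mem_range.2 (Nat.lt_succ_of_le (numUnmarked_le b)))]

end Counting

theorem count_forests_avoiding_321_2143_3142 (n : ℕ) (hn : 1 ≤ n) :
    Nat.card {p : Fin n → Option (Fin n) //
        IsForest p ∧ ForestAvoids p [3, 2, 1] ∧ ForestAvoids p [2, 1, 4, 3] ∧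
        ForestAvoids p [3, 1, 4, 2]} =
    n.factorial +
      ∑ lk ∈ (Finset.Icc 1 n ×ˢ Finset.Icc 1 n).filter
          (fun lk => lk.1 ≤ lk.2 ∧ lk.1 + lk.2 ≤ n),
        (n.factorial / 2 ^ lk.1) * (n - lk.2 - 1).choose (lk.1 - 1) * lk.2.choose lk.1 := by
  rw [card_avoiding_eq_sum]
  simp only [card_allowedParents]
  rw [sum_parentWeight_eq, ← Nat.cast_inj (R := ℚ)]
  push_cast
  simp only [totalWeight_eq, zero_add, Nat.choose_self, pow_zero, one_mul, Nat.cast_one,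
    coeff_stepSeries_pow, mul_add, sum_add_distrib]
  congr 1
  · simp
  · rw [sum_filter, sum_product_right, range_eq_Ico, sum_eq_sum_Ico_succ_bot (by omega)]
    have h₀ : ∑ l ∈ Icc 1 n, (if l ≤ 0 ∧ l + 0 ≤ n then
        (1 / 2 ^ l : ℚ) * (n - 0 - 1).choose (l - 1) * (0 : ℕ).choose l else 0) = 0 :=
      sum_eq_zero fun l hl => if_neg (by simp at hl; omega)
    rw [h₀, mul_zero, zero_add, zero_add, ← Finset.Ico_add_one_right_eq_Icc 1 n]
    refine sum_congr rfl fun k _ => ?_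
    rw [mul_sum]
    refine sum_congr rfl fun l _ => ?_
    split_ifs with h
    · rw [Nat.cast_div (two_pow_dvd_factorial (by omega)) (by positivity)]
      push_cast
      ring
    · simp
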